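/- For every c with −1 < c < 0 and every x > 0: (1/(2πi)) ∫_{Re s = c} Γ²(s/2) 2^{s−2} x^{−s} ds = K₀(x) + γ + log(x/2), where K₀(x) = ∫₀^∞ e^{−x cosh t} dt is the modified Bessel function of the second kind of order 0 and γ is the Euler–Mascheroni constant. -/

import Mathlib

open Complex

/-- The modified Bessel function of the second kind of order `0`:
`K₀(x) = ∫₀^∞ e^{-x cosh t} dt`. -/
noncomputable def K0 (x : ℝ) : ℝ :=
  ∫ t in Set.Ioi (0 : ℝ), Real.exp (-x * Real.cosh t)

open MeasureTheory Set Filter Topology Asymptotics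

section GammaLog

/-- The substitution `t = a * exp w` maps the real line onto the positive half-line. -/
lemma image_const_mul_exp {a : ℝ} (ha : 0 < a) :
    (fun w : ℝ => a * Real.exp w) '' univ = Ioi 0 := by
  ext t
  simp only [mem_image, mem_univ, true_and, mem_Ioi]
  constructor
  · rintro ⟨w, rfl⟩
    positivity
  · intro ht
    exact ⟨Real.log (t / a), by rw [Real.exp_log (by positivity)]; field_simp⟩

lemma injOn_const_mul_exp {a : ℝ} (ha : 0 < a) :
    InjOn (fun w : ℝ => a * Real.exp w) univ :=
  fun _ _ _ _ h => Real.exp_injective (mul_left_cancel₀ ha.ne' h)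

lemma integral_Ioi_eq_integral_const_mul_exp {a : ℝ} (ha : 0 < a) (g : ℝ → ℝ) :
    ∫ t in Ioi 0, g t = ∫ w, a * Real.exp w * g (a * Real.exp w) := by
  rw [← image_const_mul_exp ha, integral_image_eq_integral_abs_deriv_smul MeasurableSet.univ
    (fun w _ => ((Real.hasDerivAt_exp w).const_mul a).hasDerivWithinAt) (injOn_const_mul_exp ha)]
  simp [abs_of_pos ha]

lemma integrableOn_Ioi_iff_integrable_const_mul_exp {a : ℝ} (ha : 0 < a) (g : ℝ → ℝ) :
    IntegrableOn g (Ioi 0) ↔ Integrable fun w => a * Real.exp w * g (a * Real.exp w) := by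
  rw [← image_const_mul_exp ha, integrableOn_image_iff_integrableOn_abs_deriv_smul
    MeasurableSet.univ (fun w _ => ((Real.hasDerivAt_exp w).const_mul a).hasDerivWithinAt)
    (injOn_const_mul_exp ha)]
  simp [abs_of_pos ha]

lemma integrableOn_of_abs_le_mul_exp_neg {f : ℝ → ℝ} (hf : Continuous f) (C : ℝ)
    (h : ∀ w, 0 < w → |f w| ≤ C * ((1 + w) * Real.exp (-w))) : IntegrableOn f (Ioi 0) := by
  have h1 : IntegrableOn (fun w : ℝ => Real.exp (-w)) (Ioi 0) := by
    simpa using Real.GammaIntegral_convergent one_pos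
  have h2 : IntegrableOn (fun w : ℝ => w * Real.exp (-w)) (Ioi 0) := by
    have := Real.GammaIntegral_convergent two_pos
    norm_num at this
    exact this.congr_fun (fun w _ => mul_comm _ _) measurableSet_Ioi
  refine ((h1.add h2).const_mul C).mono' hf.aestronglyMeasurable ?_
  filter_upwards [ae_restrict_mem measurableSet_Ioi] with w hw
  simpa [add_mul] using h w hw

lemma exp_neg_mul_exp_le {a : ℝ} (ha : 0 < a) (w : ℝ) :
    Real.exp (-(a * Real.exp w)) ≤ a⁻¹ * Real.exp (-w) := by
  rw [Real.exp_neg, Real.exp_neg, ← mul_inv]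
  exact inv_anti₀ (by positivity) ((Real.add_one_le_exp _).trans' (by linarith))

lemma mul_exp_mul_exp_neg_le {a : ℝ} (ha : 0 < a) (w : ℝ) :
    a * Real.exp w * Real.exp (-(a * Real.exp w)) ≤ 2 * a⁻¹ * Real.exp (-w) := by
  have hy : 0 < a * Real.exp w := by positivity
  have h := Real.quadratic_le_exp_of_nonneg hy.le
  have : 2 * a⁻¹ * Real.exp (-w) = 2 / (a * Real.exp w) := by
    rw [Real.exp_neg]; field_simp
  rw [this, Real.exp_neg, ← div_eq_mul_inv, div_le_div_iff₀ (Real.exp_pos _) hy]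
  nlinarith

lemma one_sub_exp_neg_mul_exp_nonneg {a : ℝ} (ha : 0 < a) (w : ℝ) :
    0 ≤ 1 - Real.exp (-(a * Real.exp w)) :=
  sub_nonneg.2 (Real.exp_le_one_iff.2 (neg_nonpos.2 (by positivity)))

lemma one_sub_exp_neg_le (y : ℝ) : 1 - Real.exp (-y) ≤ y := by
  linarith [Real.add_one_le_exp (-y)]

lemma integrableOn_mul_const_mul_exp_mul_exp_neg {a : ℝ} (ha : 0 < a) :
    IntegrableOn (fun w : ℝ => w * (a * Real.exp w * Real.exp (-(a * Real.exp w)))) (Ioi 0) := by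
  refine integrableOn_of_abs_le_mul_exp_neg (by fun_prop) (2 * a⁻¹) fun w hw => ?_
  rw [abs_of_nonneg (by positivity)]
  calc _ ≤ w * (2 * a⁻¹ * Real.exp (-w)) :=
        mul_le_mul_of_nonneg_left (mul_exp_mul_exp_neg_le ha w) hw.le
    _ = 2 * a⁻¹ * (w * Real.exp (-w)) := by ring
    _ ≤ _ := by gcongr; linarith

lemma integrableOn_neg_mul_const_mul_exp_mul_exp_neg {a : ℝ} (ha : 0 < a) :
    IntegrableOn (fun w : ℝ => -w * (a * Real.exp (-w) * Real.exp (-(a * Real.exp (-w)))))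
      (Ioi 0) := by
  refine integrableOn_of_abs_le_mul_exp_neg (by fun_prop) a fun w hw => ?_
  rw [neg_mul, abs_neg, abs_of_nonneg (by positivity)]
  have h1 : Real.exp (-(a * Real.exp (-w))) ≤ 1 :=
    Real.exp_le_one_iff.2 (neg_nonpos.2 (by positivity))
  calc _ ≤ w * (a * Real.exp (-w) * 1) := by gcongr
    _ = a * (w * Real.exp (-w)) := by ring
    _ ≤ _ := by gcongr; linarith

lemma integrable_mul_const_mul_exp_mul_exp_neg {a : ℝ} (ha : 0 < a) :
    Integrable fun w : ℝ => w * (a * Real.exp w * Real.exp (-(a * Real.exp w))) := by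
  rw [← integrableOn_univ, ← Iic_union_Ioi (a := (0 : ℝ))]
  refine IntegrableOn.union ?_ (integrableOn_mul_const_mul_exp_mul_exp_neg ha)
  have h := integrableOn_neg_mul_const_mul_exp_mul_exp_neg ha
  rw [← neg_zero, ← integrableOn_Ici_iff_integrableOn_Ioi] at h
  simpa using h.comp_neg_Iic

lemma integral_log_mul_exp_neg :
    ∫ t in Ioi (0 : ℝ), Real.log t * Real.exp (-t) = -Real.eulerMascheroniConstant := by
  have h1 := Complex.hasDerivAt_GammaIntegral (s := 1) (by simp)
  have h2 : HasDerivAt Complex.GammaIntegral (-Real.eulerMascheroniConstant : ℂ) 1 := by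
    refine Complex.hasDerivAt_Gamma_one.congr_of_eventuallyEq ?_
    filter_upwards [(isOpen_lt continuous_const Complex.continuous_re).mem_nhds
      (show (0 : ℝ) < (1 : ℂ).re by simp)] with s hs
    exact (Complex.Gamma_eq_integral hs).symm
  have h := h1.unique h2
  simp only [sub_self, Complex.cpow_zero, one_mul] at h
  rw [← Complex.ofReal_inj, ← integral_complex_ofReal]
  simpa using h

lemma integral_mul_const_mul_exp_mul_exp_neg {a : ℝ} (ha : 0 < a) :
    ∫ w : ℝ, w * (a * Real.exp w * Real.exp (-(a * Real.exp w)))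
      = -(Real.eulerMascheroniConstant + Real.log a) := by
  have hlog : IntegrableOn (fun t : ℝ => Real.log t * Real.exp (-t)) (Ioi 0) := by
    rw [integrableOn_Ioi_iff_integrable_const_mul_exp one_pos]
    refine (integrable_mul_const_mul_exp_mul_exp_neg one_pos).congr (ae_of_all _ fun w => ?_)
    simp only [one_mul, Real.log_exp]
    ring
  have hexp : IntegrableOn (fun t : ℝ => Real.log a * Real.exp (-t)) (Ioi 0) := by
    have h : IntegrableOn (fun t : ℝ => Real.exp (-t)) (Ioi 0) := by
      simpa using Real.GammaIntegral_convergent one_pos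
    exact h.const_mul _
  calc _ = ∫ w : ℝ, a * Real.exp w *
        ((fun t => Real.log t * Real.exp (-t) - Real.log a * Real.exp (-t))
          (a * Real.exp w)) := by
        congr with w
        beta_reduce
        rw [Real.log_mul ha.ne' (Real.exp_ne_zero w), Real.log_exp]
        ring
    _ = ∫ t in Ioi (0 : ℝ), (Real.log t * Real.exp (-t) - Real.log a * Real.exp (-t)) :=
        (integral_Ioi_eq_integral_const_mul_exp ha
          fun t => Real.log t * Real.exp (-t) - Real.log a * Real.exp (-t)).symm
    _ = _ := by
        rw [integral_sub hlog hexp, integral_log_mul_exp_neg, integral_const_mul,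
          integral_exp_neg_Ioi_zero]
        ring

lemma integrableOn_exp_neg_mul_exp {a : ℝ} (ha : 0 < a) :
    IntegrableOn (fun w : ℝ => Real.exp (-(a * Real.exp w))) (Ioi 0) := by
  refine integrableOn_of_abs_le_mul_exp_neg (by fun_prop) a⁻¹ fun w hw => ?_
  rw [abs_of_nonneg (by positivity)]
  refine (exp_neg_mul_exp_le ha w).trans ?_
  gcongr
  nlinarith [Real.exp_pos (-w)]

lemma integrableOn_one_sub_exp_neg_mul_exp_neg {a : ℝ} (ha : 0 < a) :
    IntegrableOn (fun w : ℝ => 1 - Real.exp (-(a * Real.exp (-w)))) (Ioi 0) := by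
  refine integrableOn_of_abs_le_mul_exp_neg (by fun_prop) a fun w hw => ?_
  rw [abs_of_nonneg (one_sub_exp_neg_mul_exp_nonneg ha _)]
  refine (one_sub_exp_neg_le _).trans ?_
  gcongr
  nlinarith [Real.exp_pos (-w)]

lemma tendsto_mul_one_sub_exp_sub_exp {a : ℝ} (ha : 0 < a) :
    Tendsto (fun w : ℝ => w * (1 - Real.exp (-(a * Real.exp (-w))) - Real.exp (-(a * Real.exp w))))
      atTop (𝓝 0) := by
  have h0 : Tendsto (fun w : ℝ => (a + a⁻¹) * (w * Real.exp (-w))) atTop (𝓝 0) := by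
    simpa using (Real.tendsto_pow_mul_exp_neg_atTop_nhds_zero 1).const_mul (a + a⁻¹)
  refine squeeze_zero_norm' ?_ h0
  filter_upwards [eventually_gt_atTop 0] with w hw
  rw [Real.norm_eq_abs, abs_mul, abs_of_pos hw]
  have h1 := one_sub_exp_neg_mul_exp_nonneg ha (-w)
  have h2 := one_sub_exp_neg_le (a * Real.exp (-w))
  have h3 := exp_neg_mul_exp_le ha w
  have h4 := Real.exp_pos (-(a * Real.exp w))
  have h5 := Real.exp_pos (-w)
  have : |1 - Real.exp (-(a * Real.exp (-w))) - Real.exp (-(a * Real.exp w))|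
      ≤ (a + a⁻¹) * Real.exp (-w) := by
    rw [add_mul, abs_le]
    constructor <;> nlinarith
  calc _ ≤ w * ((a + a⁻¹) * Real.exp (-w)) := by gcongr
    _ = _ := by ring

/-- The representation `γ + log a = ∫₀ᵃ (1 - e⁻ᵘ) du/u - ∫ₐ^∞ e⁻ᵘ du/u`, in the variables
`u = a * exp (-w)` and `u = a * exp w` respectively. -/
lemma integral_one_sub_exp_sub_exp {a : ℝ} (ha : 0 < a) :
    ∫ w in Ioi (0 : ℝ), (1 - Real.exp (-(a * Real.exp (-w))) - Real.exp (-(a * Real.exp w)))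
      = Real.eulerMascheroniConstant + Real.log a := by
  set g : ℝ → ℝ := fun w => w * (a * Real.exp w * Real.exp (-(a * Real.exp w))) with hg
  have hg1 : IntegrableOn g (Ioi 0) := integrableOn_mul_const_mul_exp_mul_exp_neg ha
  have hg2 : IntegrableOn (fun w => g (-w)) (Ioi 0) :=
    integrableOn_neg_mul_const_mul_exp_mul_exp_neg ha
  have hF : IntegrableOn
      (fun w => 1 - Real.exp (-(a * Real.exp (-w))) - Real.exp (-(a * Real.exp w))) (Ioi 0) :=
    (integrableOn_one_sub_exp_neg_mul_exp_neg ha).sub (integrableOn_exp_neg_mul_exp ha)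
  have hG : IntegrableOn (fun w => g (-w) + g w) (Ioi 0) := hg2.add hg1
  have hderiv : ∀ w ∈ Ici (0 : ℝ), HasDerivAt
      (fun w : ℝ => w * (1 - Real.exp (-(a * Real.exp (-w))) - Real.exp (-(a * Real.exp w))))
      ((1 - Real.exp (-(a * Real.exp (-w))) - Real.exp (-(a * Real.exp w)))
        + (g (-w) + g w)) w := by
    intro w _
    have h1 : HasDerivAt (fun w : ℝ => Real.exp (-(a * Real.exp (-w))))
        (Real.exp (-(a * Real.exp (-w))) * -(a * (Real.exp (-w) * -1))) w :=
      (((hasDerivAt_neg w).exp.const_mul a).neg).exp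
    have h2 : HasDerivAt (fun w : ℝ => Real.exp (-(a * Real.exp w)))
        (Real.exp (-(a * Real.exp w)) * -(a * Real.exp w)) w :=
      (((Real.hasDerivAt_exp w).const_mul a).neg).exp
    refine ((hasDerivAt_id w).mul ((h1.const_sub 1).sub h2)).congr_deriv ?_
    simp only [hg, id, Pi.sub_apply]
    ring
  have h := integral_Ioi_of_hasDerivAt_of_tendsto' hderiv (hF.add hG)
    (tendsto_mul_one_sub_exp_sub_exp ha)
  rw [integral_add hF hG, integral_add hg2 hg1, integral_comp_neg_Ioi, neg_zero,
    intervalIntegral.integral_Iic_add_Ioi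
      (integrable_mul_const_mul_exp_mul_exp_neg ha).integrableOn hg1,
    integral_mul_const_mul_exp_mul_exp_neg ha] at h
  linarith

/-- The multiplicative self-convolution of `exp (-t) - 1`, evaluated at `a ^ 2`. -/
lemma integral_exp_neg_sub_one_mul {a : ℝ} (ha : 0 < a) :
    ∫ t in Ioi (0 : ℝ), (Real.exp (-t) - 1) * (Real.exp (-(a ^ 2 / t)) - 1) / t
      = 2 * (K0 (2 * a) + Real.eulerMascheroniConstant + Real.log a) := by
  set f : ℝ → ℝ := fun w =>
    (Real.exp (-(a * Real.exp w)) - 1) * (Real.exp (-(a * Real.exp (-w))) - 1) with hf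
  have hcosh : ∀ w : ℝ, Real.exp (-(2 * a) * Real.cosh w)
      = Real.exp (-(a * Real.exp w)) * Real.exp (-(a * Real.exp (-w))) := by
    intro w
    rw [Real.cosh_eq, ← Real.exp_add]
    ring_nf
  have hK : IntegrableOn (fun w => Real.exp (-(2 * a) * Real.cosh w)) (Ioi 0) := by
    refine (integrableOn_exp_neg_mul_exp ha).mono' (by fun_prop) (ae_of_all _ fun w => ?_)
    rw [Real.norm_eq_abs, Real.abs_exp, hcosh]
    exact mul_le_of_le_one_right (Real.exp_pos _).le
      (Real.exp_le_one_iff.2 (neg_nonpos.2 (by positivity)))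
  have hE : IntegrableOn
      (fun w => 1 - Real.exp (-(a * Real.exp (-w))) - Real.exp (-(a * Real.exp w))) (Ioi 0) :=
    (integrableOn_one_sub_exp_neg_mul_exp_neg ha).sub (integrableOn_exp_neg_mul_exp ha)
  have heven : ∀ w, f w = f |w| := by
    intro w
    rcases abs_choice w with h | h <;> rw [h]
    simp only [hf, neg_neg]
    ring
  calc _ = ∫ w, f w := by
        rw [integral_Ioi_eq_integral_const_mul_exp ha]
        congr with w
        have : a ^ 2 / (a * Real.exp w) = a * Real.exp (-w) := by
          rw [Real.exp_neg]; field_simp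
        rw [this, mul_div_cancel₀ _ (by positivity)]
    _ = 2 * ∫ w in Ioi (0 : ℝ), f w := by
        rw [← integral_comp_abs (f := f)]
        simp_rw [← heven]
    _ = 2 * ∫ w in Ioi (0 : ℝ), (Real.exp (-(2 * a) * Real.cosh w) +
          (1 - Real.exp (-(a * Real.exp (-w))) - Real.exp (-(a * Real.exp w)))) := by
        congr with w
        rw [hcosh]
        ring
    _ = _ := by
        rw [integral_add hK hE, integral_one_sub_exp_sub_exp ha, K0]
        ring

end GammaLog

section GammaSq

lemma continuous_exp_neg_sub_one :
    Continuous fun t : ℝ => ((Real.exp (-t) - 1 : ℝ) : ℂ) := by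
  fun_prop

lemma norm_exp_neg_sub_one_le {t : ℝ} (ht : 0 ≤ t) : ‖((Real.exp (-t) - 1 : ℝ) : ℂ)‖ ≤ t := by
  have := Real.exp_le_one_iff.2 (neg_nonpos.2 ht)
  rw [norm_real, Real.norm_eq_abs, abs_of_nonpos (by linarith)]
  linarith [Real.add_one_le_exp (-t)]

lemma norm_exp_neg_sub_one_le_one {t : ℝ} (ht : 0 ≤ t) :
    ‖((Real.exp (-t) - 1 : ℝ) : ℂ)‖ ≤ 1 := by
  have := Real.exp_le_one_iff.2 (neg_nonpos.2 ht)
  rw [norm_real, Real.norm_eq_abs, abs_of_nonpos (by linarith)]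
  linarith [Real.exp_pos (-t)]

lemma mellinConvergent_exp_neg_sub_one {s : ℂ} (h1 : -1 < s.re) (h2 : s.re < 0) :
    MellinConvergent (fun t : ℝ => ((Real.exp (-t) - 1 : ℝ) : ℂ)) s := by
  refine mellinConvergent_of_isBigO_rpow (a := 0) (b := -1)
    (continuous_exp_neg_sub_one.continuousOn.locallyIntegrableOn measurableSet_Ioi) ?_ h2 ?_ h1
  · refine IsBigO.of_bound 1 ?_
    filter_upwards [eventually_gt_atTop 0] with t ht
    simpa using norm_exp_neg_sub_one_le_one ht.le
  · refine IsBigO.of_bound 1 ?_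
    filter_upwards [self_mem_nhdsWithin] with t ht
    rw [neg_neg, Real.rpow_one, one_mul, Real.norm_of_nonneg (le_of_lt ht)]
    exact norm_exp_neg_sub_one_le (le_of_lt ht)

/-- The Cahen-Mellin integral in the strip `-1 < re s < 0`. -/
lemma mellin_exp_neg_sub_one {s : ℂ} (h1 : -1 < s.re) (h2 : s.re < 0) :
    mellin (fun t : ℝ => ((Real.exp (-t) - 1 : ℝ) : ℂ)) s = Gamma s := by
  have hs : s ≠ 0 := by rintro rfl; simp at h2
  have hs1 : 0 < (s + 1).re := by simpa using by linarith
  have hu : ∀ t ∈ Ioi (0 : ℝ), HasDerivAt (fun t : ℝ => ((Real.exp (-t) - 1 : ℝ) : ℂ))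
      (-(Real.exp (-t) : ℂ)) t := by
    intro t _
    have : HasDerivAt (fun t : ℝ => Real.exp (-t) - 1) (-Real.exp (-t)) t := by
      simpa using (hasDerivAt_neg t).exp.sub_const 1
    simpa using this.ofReal_comp
  have hv : ∀ t ∈ Ioi (0 : ℝ), HasDerivAt (fun t : ℝ => (t : ℂ) ^ s / s) ((t : ℂ) ^ (s - 1)) t := by
    intro t ht
    have := hasDerivAt_ofReal_cpow_const' (ne_of_gt ht) (r := s - 1) (by simpa using hs)
    simpa using this
  have hbound : ∀ t ∈ Ioi (0 : ℝ), ∀ r, ‖((Real.exp (-t) - 1 : ℝ) : ℂ)‖ ≤ t ^ r →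
      ‖((Real.exp (-t) - 1 : ℝ) : ℂ) * ((t : ℂ) ^ s / s)‖ ≤ t ^ (r + s.re) * ‖s‖⁻¹ := by
    intro t ht r hr
    rw [norm_mul, norm_div, norm_cpow_eq_rpow_re_of_pos ht, Real.rpow_add ht, mul_assoc,
      div_eq_mul_inv]
    have := Real.rpow_pos_of_pos ht s.re
    gcongr
  have h := integral_Ioi_mul_deriv_eq_deriv_mul hu hv ?_ ?_ (a' := 0) (b' := 0) ?_ ?_
  · rw [mellin]
    calc _ = _ := by
          congr with t
          rw [smul_eq_mul, mul_comm]
      _ = _ := h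
      _ = s⁻¹ * ∫ t : ℝ in Ioi 0, (Real.exp (-t) : ℂ) * (t : ℂ) ^ (s + 1 - 1) := by
          rw [← integral_const_mul, sub_zero, zero_sub, ← integral_neg]
          congr with t
          rw [add_sub_cancel_right]
          ring
      _ = s⁻¹ * Gamma (s + 1) := by rw [Gamma_eq_integral hs1]; rfl
      _ = _ := by rw [Gamma_add_one s hs]; field_simp
  · exact (mellinConvergent_exp_neg_sub_one h1 h2).congr_fun (fun t _ => mul_comm _ _)
      measurableSet_Ioi
  · refine ((GammaIntegral_convergent hs1).neg.div_const s).congr (ae_of_all _ fun t => ?_)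
    simp only [Pi.neg_apply, Pi.mul_apply, add_sub_cancel_right]
    ring
  · have h0 : Tendsto (fun t : ℝ => t ^ (1 + s.re) * ‖s‖⁻¹) (𝓝[>] 0) (𝓝 0) := by
      have : Tendsto (fun t : ℝ => t ^ (1 + s.re)) (𝓝[>] 0) (𝓝 0) := by
        have := (Real.continuousAt_rpow_const 0 (1 + s.re) (Or.inr (by linarith))).tendsto
        rw [Real.zero_rpow (by linarith)] at this
        exact this.mono_left nhdsWithin_le_nhds
      simpa using this.mul_const ‖s‖⁻¹
    refine squeeze_zero_norm' ?_ h0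
    filter_upwards [self_mem_nhdsWithin] with t ht
    exact hbound t ht 1 (by simpa using norm_exp_neg_sub_one_le (le_of_lt ht))
  · have h0 : Tendsto (fun t : ℝ => t ^ (0 + s.re) * ‖s‖⁻¹) atTop (𝓝 0) := by
      have := (tendsto_rpow_neg_atTop (neg_pos.2 h2)).mul_const ‖s‖⁻¹
      simpa using this
    refine squeeze_zero_norm' ?_ h0
    filter_upwards [eventually_gt_atTop 0] with t ht
    exact hbound t ht 0 (by simpa using norm_exp_neg_sub_one_le_one ht.le)

lemma norm_Gamma_le_Gamma_re {s : ℂ} (hs : 0 < s.re) : ‖Gamma s‖ ≤ Real.Gamma s.re := by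
  rw [Gamma_eq_integral hs, GammaIntegral, Real.Gamma_eq_integral hs]
  refine (norm_integral_le_integral_norm _).trans_eq
    (setIntegral_congr_fun measurableSet_Ioi fun t ht => ?_)
  rw [norm_mul, norm_cpow_eq_rpow_re_of_pos ht, norm_real, Real.norm_of_nonneg (Real.exp_pos _).le,
    sub_re, one_re]

lemma verticalIntegrable_Gamma {σ : ℝ} (h1 : -1 < σ) (h2 : σ < 0) :
    VerticalIntegrable Gamma σ := by
  have hre : ∀ y : ℝ, ((σ : ℂ) + y * I).re = σ := by simp
  have him : ∀ y : ℝ, ((σ : ℂ) + y * I).im = y := by simp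
  have hcont : Continuous fun y : ℝ => Gamma (σ + y * I) := by
    refine continuous_iff_continuousAt.2 fun y => ContinuousAt.comp (f := fun y : ℝ => (σ : ℂ) + y * I)
      (continuousAt_Gamma _ fun m hm => ?_) (by fun_prop)
    have := congrArg re hm
    rw [hre, neg_re, natCast_re] at this
    rcases m with _ | m
    · simp at this; linarith
    · push_cast at this; linarith [(Nat.cast_nonneg m : (0 : ℝ) ≤ m)]
  have hlower : ∀ (z : ℂ) (d : ℝ), 0 < d → d ≤ 1 → d ≤ |z.re| → d * √(1 + z.im ^ 2) ≤ ‖z‖ := by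
    intro z d hd hd1 hdz
    rw [norm_eq_sqrt_sq_add_sq]
    refine Real.le_sqrt_of_sq_le ?_
    rw [mul_pow, Real.sq_sqrt (by positivity)]
    have : d ^ 2 ≤ z.re ^ 2 := sq_le_sq.2 (by rwa [abs_of_pos hd])
    nlinarith [sq_nonneg z.im, mul_le_one₀ hd1 hd.le hd1]
  refine (integrable_inv_one_add_sq.const_mul
    (Real.Gamma (σ + 2) * (-σ * (σ + 1))⁻¹)).mono' hcont.aestronglyMeasurable
    (ae_of_all _ fun y => ?_)
  set s : ℂ := σ + y * I with hs
  have hs0 : s ≠ 0 := fun h => by have := congrArg re h; rw [hre] at this; simp at this; linarith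
  have hs1 : s + 1 ≠ 0 := fun h => by
    have := congrArg re h; rw [add_re, hre] at this; simp at this; linarith
  have hG : Gamma s = Gamma (s + 2) / (s * (s + 1)) := by
    rw [show s + 2 = s + 1 + 1 by ring, Gamma_add_one _ hs1, Gamma_add_one _ hs0]
    field_simp
  have hle : ‖Gamma (s + 2)‖ ≤ Real.Gamma (σ + 2) := by
    have := norm_Gamma_le_Gamma_re (s := s + 2) (by rw [add_re, hre]; norm_num; linarith)
    rwa [add_re, hre, re_ofNat] at this
  have hl0 := hlower s (-σ) (by linarith) (by linarith) (by rw [hre]; exact neg_le_abs σ)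
  have hl1 := hlower (s + 1) (σ + 1) (by linarith) (by linarith)
    (by rw [add_re, hre, one_re]; exact le_abs_self _)
  rw [add_im, one_im, add_zero, him] at hl1
  rw [him] at hl0
  have hσ : 0 < -σ * (σ + 1) := mul_pos (by linarith) (by linarith)
  rw [hG, norm_div, norm_mul, mul_assoc, ← mul_inv, ← div_eq_mul_inv]
  refine div_le_div₀ (norm_nonneg _ |>.trans hle) hle (by positivity) ?_
  calc _ = (-σ * √(1 + y ^ 2)) * ((σ + 1) * √(1 + y ^ 2)) := by
        linear_combination (-σ * (σ + 1)) * -(Real.mul_self_sqrt (show 0 ≤ 1 + y ^ 2 by positivity))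
    _ ≤ _ := mul_le_mul hl0 hl1 (mul_nonneg (by linarith) (by positivity)) (norm_nonneg _)

lemma mellinInv_Gamma {σ : ℝ} (h1 : -1 < σ) (h2 : σ < 0) {x : ℝ} (hx : 0 < x) :
    mellinInv σ Gamma x = ((Real.exp (-x) - 1 : ℝ) : ℂ) := by
  have hm : ∀ y : ℝ, mellin (fun t : ℝ => ((Real.exp (-t) - 1 : ℝ) : ℂ)) (σ + y * I)
      = Gamma (σ + y * I) := fun y =>
    mellin_exp_neg_sub_one (by simpa using h1) (by simpa using h2)
  rw [← mellinInv_mellin_eq σ _ hx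
    (mellinConvergent_exp_neg_sub_one (by simpa using h1) (by simpa using h2))
    ((verticalIntegrable_Gamma h1 h2).congr (ae_of_all _ fun y => (hm y).symm))
    continuous_exp_neg_sub_one.continuousAt]
  simp_rw [mellinInv, hm]

lemma mellinInv_Gamma_sq {σ : ℝ} (h1 : -1 < σ) (h2 : σ < 0) {x : ℝ} (hx : 0 < x) :
    mellinInv σ (fun s => Gamma s ^ 2) x =
      ((∫ t in Ioi (0 : ℝ), (Real.exp (-t) - 1) * (Real.exp (-(x / t)) - 1) / t : ℝ) : ℂ) := by
  set φ : ℝ → ℂ := fun t => ((Real.exp (-t) - 1 : ℝ) : ℂ) with hφ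
  have hconv := mellinConvergent_exp_neg_sub_one (s := σ) (by simpa using h1) (by simpa using h2)
  have hvert := verticalIntegrable_Gamma h1 h2
  set F : ℝ → ℝ → ℂ := fun y t =>
    (x : ℂ) ^ (-(σ + y * I)) * Gamma (σ + y * I) * ((t : ℂ) ^ (σ + y * I - 1) * φ t) with hF
  have hint : Integrable (Function.uncurry F) (volume.prod (volume.restrict (Ioi 0))) := by
    have hb := ((hvert.norm.const_mul (x ^ (-σ))).mul_prod hconv.norm)
    refine hb.mono' ?_ ?_
    · have hmeas : Measurable fun p : ℝ × ℝ => ((p.2 : ℂ) ^ (σ + p.1 * I - 1) * φ p.2) := by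
        fun_prop
      have hmeas' : Measurable fun p : ℝ × ℝ => (x : ℂ) ^ (-(σ + p.1 * I)) := by
        fun_prop
      exact (hmeas'.aestronglyMeasurable.mul hvert.aestronglyMeasurable.comp_fst).mul
        hmeas.aestronglyMeasurable
    · filter_upwards [Measure.quasiMeasurePreserving_snd.ae (ae_restrict_mem measurableSet_Ioi)]
        with p hp
      refine le_of_eq ?_
      simp only [hF, Function.uncurry, norm_mul, norm_smul]
      rw [norm_cpow_eq_rpow_re_of_pos hx, norm_cpow_eq_rpow_re_of_pos hp,
        norm_cpow_eq_rpow_re_of_pos hp]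
      simp [hφ]
  calc mellinInv σ (fun s => Gamma s ^ 2) x
      = (1 / (2 * Real.pi)) • ∫ y : ℝ, ∫ t in Ioi (0 : ℝ), F y t := by
        rw [mellinInv]
        congr with y
        rw [integral_const_mul]
        have := mellin_exp_neg_sub_one (s := σ + y * I) (by simpa using h1) (by simpa using h2)
        rw [mellin] at this
        simp only [smul_eq_mul] at this
        rw [this, smul_eq_mul]
        ring
    _ = (1 / (2 * Real.pi)) • ∫ t in Ioi (0 : ℝ), ∫ y : ℝ, F y t := by
        rw [integral_integral_swap hint]
    _ = ∫ t in Ioi (0 : ℝ), φ t / t * mellinInv σ Gamma (x / t) := by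
        rw [← integral_smul]
        refine setIntegral_congr_fun measurableSet_Ioi fun t ht => ?_
        have ht' : (t : ℂ) ≠ 0 := ofReal_ne_zero.2 (ne_of_gt ht)
        rw [mellinInv, mul_smul_comm, ← integral_const_mul]
        congr with y
        simp only [hF]
        rw [ofReal_div, div_cpow_ofReal_nonneg hx.le (le_of_lt ht), cpow_sub _ _ ht', cpow_one,
          cpow_neg (t : ℂ), smul_eq_mul]
        field_simp
    _ = ∫ t in Ioi (0 : ℝ), (((Real.exp (-t) - 1) * (Real.exp (-(x / t)) - 1) / t : ℝ) : ℂ) := by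
        refine setIntegral_congr_fun measurableSet_Ioi fun t ht => ?_
        rw [mellinInv_Gamma h1 h2 (div_pos hx ht)]
        simp only [hφ]
        push_cast
        ring
    _ = _ := integral_complex_ofReal

end GammaSq

/-- For `-1 < c < 0` and `x > 0`,
`(1/(2πi)) ∫_{Re s = c} Γ²(s/2) 2^{s-2} x^{-s} ds = K₀(x) + γ + log(x/2)`. -/
theorem besselK_inverse_mellin (c : ℝ) (hc₁ : -1 < c) (hc₂ : c < 0)
    (x : ℝ) (hx : 0 < x) :
    mellinInv c (fun s => (Complex.Gamma (s / 2)) ^ 2 * (2 : ℂ) ^ (s - 2)) x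
      = ((K0 x + Real.eulerMascheroniConstant + Real.log (x / 2) : ℝ) : ℂ) := by
  have ha : 0 < x / 2 := by positivity
  have hscale : mellinInv c (fun s => (Gamma (s / 2)) ^ 2 * (2 : ℂ) ^ (s - 2)) x
      = (1 / 2 : ℂ) * mellinInv (c / 2) (fun s => Gamma s ^ 2) ((x / 2) ^ 2) := by
    set H : ℝ → ℂ := fun y => (((x / 2) ^ 2 : ℝ) : ℂ) ^ (-(((c / 2 : ℝ) : ℂ) + y * I))
      * Gamma (((c / 2 : ℝ) : ℂ) + y * I) ^ 2 with hH
    have hsub : ∫ y : ℝ, H (y / 2) = 2 * ∫ y : ℝ, H y := by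
      rw [Measure.integral_comp_div]
      simp
    have hpt : ∀ y : ℝ, (x : ℂ) ^ (-((c : ℂ) + y * I)) *
        (Gamma ((c + y * I) / 2) ^ 2 * (2 : ℂ) ^ ((c : ℂ) + y * I - 2)) = 1 / 4 * H (y / 2) := by
      intro y
      have hs : ((c / 2 : ℝ) : ℂ) + (y / 2 : ℝ) * I = (c + y * I) / 2 := by push_cast; ring
      simp only [hH]
      rw [hs]
      generalize (c : ℂ) + y * I = s
      have hsq : (((x / 2) ^ 2 : ℝ) : ℂ) ^ (-(s / 2)) = (x : ℂ) ^ (-s) * (2 : ℂ) ^ s := by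
        rw [sq, ofReal_mul, mul_cpow_ofReal_nonneg ha.le ha.le,
          ← cpow_add _ _ (ofReal_ne_zero.2 ha.ne'), ofReal_div,
          div_cpow_ofReal_nonneg hx.le zero_le_two, show -(s / 2) + -(s / 2) = -s by ring,
          cpow_neg ((2 : ℝ) : ℂ), div_inv_eq_mul, ofReal_ofNat]
      rw [hsq, cpow_sub _ _ two_ne_zero, show (2 : ℂ) ^ (2 : ℂ) = 4 by
        rw [show (2 : ℂ) = ((2 : ℕ) : ℂ) by simp, cpow_natCast]; norm_num]
      ring
    simp_rw [mellinInv, smul_eq_mul, hpt, integral_const_mul, hsub, real_smul]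
    ring
  rw [hscale, mellinInv_Gamma_sq (by linarith) (by linarith) (by positivity),
    integral_exp_neg_sub_one_mul ha, show 2 * (x / 2) = x by ring]
  push_cast
  ring
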